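/- Let n, p ≥ 1, let C• and C̃ be symmetric p-tensors on ℝ^n, let W ∈ ℝ^{n×n} be nonsingular, and let s ∈ ℝ^n be nonzero. Then the unique symmetric p-tensor C+ minimizing ‖(C − C•)[W]^p‖_F over all symmetric p-tensors C satisfying C[s] = C̃[s] satisfies the recursive relation (C+ − C̃)[W]^p = (C• − C̃)[W]^p [I − (W^{-1}s s^T W^{-T})/(s^T W^{-T} W^{-1} s)]^p. -/

import Mathlib

open scoped BigOperators
open Matrix Filter

noncomputable section

/-- A `q`-tensor on `ℝ^n` (a multilinear map `(ℝ^n)^q → ℝ`), represented by its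
coefficient array on the standard basis. -/
abbrev Tensor (n q : ℕ) := (Fin q → Fin n) → ℝ

namespace Tensor

/-- Evaluation of a tensor (as a multilinear map) on the vectors `u 0, …, u (q-1)`. -/
def eval {n q : ℕ} (T : Tensor n q) (u : Fin q → (Fin n → ℝ)) : ℝ :=
  ∑ i : Fin q → Fin n, T i * ∏ k, u k (i k)

/-- A tensor is symmetric if it is invariant under all permutations of its arguments. -/
def Symm {n q : ℕ} (T : Tensor n q) : Prop :=
  ∀ σ : Equiv.Perm (Fin q), ∀ i : Fin q → Fin n, T (i ∘ σ) = T i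

/-- The Frobenius norm of a tensor: the Euclidean norm of its coefficient array. -/
def frobNorm {n q : ℕ} (T : Tensor n q) : ℝ :=
  Real.sqrt (∑ i : Fin q → Fin n, (T i) ^ 2)

/-- The Frobenius inner product of two tensors. -/
def finner {n q : ℕ} (T S : Tensor n q) : ℝ := ∑ i : Fin q → Fin n, T i * S i

/-- The symmetric projection `P_sym(T) = (1/q!) ∑_σ σ(T)`. -/
def psym {n q : ℕ} (T : Tensor n q) : Tensor n q :=
  fun i => ((Nat.factorial q : ℝ))⁻¹ * ∑ σ : Equiv.Perm (Fin q), T (i ∘ σ)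

/-- `T[W]^q`: apply the matrix `W` to every argument of `T`. -/
def applyMat {n q : ℕ} (T : Tensor n q) (W : Matrix (Fin n) (Fin n) ℝ) : Tensor n q :=
  fun j => ∑ i : Fin q → Fin n, T i * ∏ k, W (i k) (j k)

/-- `T[v]^j`: fix the first `j` arguments of `T` to the vector `v`,
yielding a `(q-j)`-tensor. -/
def fixMany {n q : ℕ} (T : Tensor n q) (v : Fin n → ℝ) (j : ℕ) : Tensor n (q - j) :=
  fun idx => ∑ i : Fin j → Fin n, (∏ k, v (i k)) *
    T (fun k => if h : (k : ℕ) < j then i ⟨k, h⟩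
        else idx ⟨(k : ℕ) - j, by have hk := k.isLt; omega⟩)

/-- The outer product of two tensors. -/
def outer {n a b : ℕ} (T : Tensor n a) (S : Tensor n b) : Tensor n (a + b) :=
  fun idx => T (fun k => idx (Fin.castAdd b k)) * S (fun k => idx (Fin.natAdd a k))

/-- Reindexing a tensor along an equality of orders. -/
def castOrder {n a b : ℕ} (h : a = b) (T : Tensor n a) : Tensor n b :=
  fun idx => T (fun k => idx (Fin.cast h k))

/-- Apply a matrix to the first argument of a tensor only. -/
def applyFirst {n q : ℕ} (hq : 0 < q) (T : Tensor n q) (M : Matrix (Fin n) (Fin n) ℝ) :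
    Tensor n q :=
  fun idx => ∑ i : Fin n, M i (idx ⟨0, hq⟩) * T (Function.update idx ⟨0, hq⟩ i)

end Tensor

/-- `⊗^j v`, the `j`-fold outer product of a vector `v` with itself. -/
def vpow {n : ℕ} (j : ℕ) (v : Fin n → ℝ) : Tensor n j := fun idx => ∏ k, v (idx k)

/-- The Euclidean (2-) norm of a vector in `ℝ^n`. -/
def vnorm {n : ℕ} (v : Fin n → ℝ) : ℝ := Real.sqrt (∑ i, v i ^ 2)

/-- The injective (2-) norm of a tensor:
the supremum of `|T[u_1,…,u_q]|` over unit vectors. -/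
def Tensor.inj2Norm {n q : ℕ} (T : Tensor n q) : ℝ :=
  sSup ((fun u => |T.eval u|) '' {u : Fin q → Fin n → ℝ | ∀ k, vnorm (u k) = 1})

/-- The spectral (operator 2-) norm of a matrix. -/
def specNorm {n : ℕ} (M : Matrix (Fin n) (Fin n) ℝ) : ℝ :=
  ‖Matrix.toEuclideanCLM (𝕜 := ℝ) M‖

/-- The orthogonal projection `I - w wᵀ / (wᵀ w)` onto the orthogonal complement of `w`. -/
def projPerp {n : ℕ} (w : Fin n → ℝ) : Matrix (Fin n) (Fin n) ℝ :=
  1 - (w ⬝ᵥ w)⁻¹ • Matrix.vecMulVec w w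

/-- `Cp` is a least-change symmetric update of `Cb` in the `W`-weighted Frobenius norm,
subject to the secant equation `Cp[s] = R`. -/
def IsSecantUpdate {n p : ℕ} (Cb : Tensor n p) (R : Tensor n (p - 1))
    (W : Matrix (Fin n) (Fin n) ℝ) (s : Fin n → ℝ) (Cp : Tensor n p) : Prop :=
  Cp.Symm ∧ Cp.fixMany s 1 = R ∧
    ∀ C : Tensor n p, C.Symm → C.fixMany s 1 = R →
      ((Cp - Cb).applyMat W).frobNorm ≤ ((C - Cb).applyMat W).frobNorm

/-- The explicit higher-order secant update formula of Theorem 1 (b):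
`C• + ∑_{j=1}^p (-1)^{j+1} C(p,j) (vᵀs)^{-j} P_sym((⊗^j v) ⊗ (C̃ - C•)[s]^j)`. -/
def hosuFormula {n p : ℕ} (Cb Ct : Tensor n p) (v s : Fin n → ℝ) : Tensor n p :=
  Cb + ∑ j ∈ (Finset.Icc 1 p).attach,
    ((-1 : ℝ) ^ ((j : ℕ) + 1) * (p.choose (j : ℕ) : ℝ) * ((v ⬝ᵥ s) ^ (j : ℕ))⁻¹) •
      Tensor.castOrder (Nat.add_sub_cancel' (Finset.mem_Icc.mp j.2).2)
        (Tensor.psym ((vpow (j : ℕ) v).outer ((Ct - Cb).fixMany s (j : ℕ))))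

/-- The coefficient array of the `q`-th derivative of `f : ℝ^n → ℝ`
(domain given the sup-norm product structure). -/
def derivTensorPi {n : ℕ} (q : ℕ) (f : (Fin n → ℝ) → ℝ) (x : Fin n → ℝ) : Tensor n q :=
  fun idx => iteratedFDeriv ℝ q f x (fun k => Pi.single (idx k) 1)

/-- The coefficient array of the `q`-th derivative of `f : ℝ^n → ℝ`
(domain given the Euclidean structure). -/
def derivTensorE {n : ℕ} (q : ℕ) (f : EuclideanSpace ℝ (Fin n) → ℝ)
    (x : EuclideanSpace ℝ (Fin n)) : Tensor n q :=
  fun idx => iteratedFDeriv ℝ q f x (fun k => EuclideanSpace.single (idx k) 1)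

/-- Reinterpret a Euclidean vector as a plain vector in `Fin n → ℝ`. -/
def toVec {n : ℕ} (y : EuclideanSpace ℝ (Fin n)) : Fin n → ℝ := y

namespace Tensor

variable {n q : ℕ}

theorem applyMat_eq_eval (T : Tensor n q) (W : Matrix (Fin n) (Fin n) ℝ) (j : Fin q → Fin n) :
    T.applyMat W j = T.eval fun k a => W a (j k) :=
  rfl

theorem applyMat_add (T S : Tensor n q) (W : Matrix (Fin n) (Fin n) ℝ) :
    (T + S).applyMat W = T.applyMat W + S.applyMat W := by
  ext j
  simp [applyMat, add_mul, Finset.sum_add_distrib]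

theorem applyMat_sub (T S : Tensor n q) (W : Matrix (Fin n) (Fin n) ℝ) :
    (T - S).applyMat W = T.applyMat W - S.applyMat W := by
  ext j
  simp [applyMat, sub_mul, Finset.sum_sub_distrib]

theorem applyMat_applyMat (T : Tensor n q) (A B : Matrix (Fin n) (Fin n) ℝ) :
    (T.applyMat A).applyMat B = T.applyMat (A * B) := by
  ext j
  simp only [applyMat, Matrix.mul_apply, Finset.sum_mul]
  rw [Finset.sum_comm]
  refine Finset.sum_congr rfl fun i _ => ?_
  rw [Finset.prod_univ_sum, Fintype.piFinset_univ, Finset.mul_sum]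
  simp only [Finset.prod_mul_distrib, mul_assoc]

theorem applyMat_one (T : Tensor n q) : T.applyMat 1 = T := by
  ext j
  rw [applyMat, Finset.sum_eq_single j]
  · simp
  · intro i _ hij
    obtain ⟨k, hk⟩ := Function.ne_iff.mp hij
    have h0 : ∏ k, (1 : Matrix (Fin n) (Fin n) ℝ) (i k) (j k) = 0 :=
      Finset.prod_eq_zero (Finset.mem_univ k) (Matrix.one_apply_ne hk)
    exact mul_eq_zero_of_right _ h0
  · simp

theorem finner_applyMat_left (T S : Tensor n q) (A : Matrix (Fin n) (Fin n) ℝ) :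
    finner (T.applyMat A) S = finner T (S.applyMat Aᵀ) := by
  simp only [finner, applyMat, Finset.sum_mul, Finset.mul_sum, Matrix.transpose_apply]
  rw [Finset.sum_comm]
  exact Finset.sum_congr rfl fun i _ => Finset.sum_congr rfl fun j _ => by ring

theorem Symm.eval_comp {T : Tensor n q} (hT : T.Symm) (σ : Equiv.Perm (Fin q))
    (u : Fin q → Fin n → ℝ) : T.eval (u ∘ σ) = T.eval u := by
  refine (Fintype.sum_equiv (Equiv.arrowCongr σ.symm (Equiv.refl (Fin n))) _ _ fun i => ?_).symm
  have h : (Equiv.arrowCongr σ.symm (Equiv.refl (Fin n))) i = i ∘ σ := by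
    ext; simp [Equiv.arrowCongr]
  rw [h, hT σ i, ← Equiv.prod_comp σ fun k => u k (i k)]
  rfl

theorem Symm.applyMat {T : Tensor n q} (hT : T.Symm) (W : Matrix (Fin n) (Fin n) ℝ) :
    (T.applyMat W).Symm := fun σ j => by
  rw [applyMat_eq_eval, applyMat_eq_eval, ← hT.eval_comp σ fun k a => W a (j k)]
  rfl

theorem Symm.add {T S : Tensor n q} (hT : T.Symm) (hS : S.Symm) : (T + S).Symm := fun σ i => by
  rw [Pi.add_apply, Pi.add_apply, hT σ i, hS σ i]

theorem Symm.sub {T S : Tensor n q} (hT : T.Symm) (hS : S.Symm) : (T - S).Symm := fun σ i => by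
  rw [Pi.sub_apply, Pi.sub_apply, hT σ i, hS σ i]

theorem fixMany_add (T S : Tensor n q) (v : Fin n → ℝ) (j : ℕ) :
    (T + S).fixMany v j = T.fixMany v j + S.fixMany v j := by
  ext idx
  simp [fixMany, mul_add, Finset.sum_add_distrib]

theorem fixMany_sub (T S : Tensor n q) (v : Fin n → ℝ) (j : ℕ) :
    (T - S).fixMany v j = T.fixMany v j - S.fixMany v j := by
  ext idx
  simp [fixMany, mul_sub, Finset.sum_sub_distrib]

theorem fixMany_one_apply {m : ℕ} (T : Tensor n (m + 1)) (v : Fin n → ℝ) (idx : Fin m → Fin n) :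
    T.fixMany v 1 idx = ∑ a, v a * T (Fin.cons a idx) := by
  refine Fintype.sum_equiv (Equiv.funUnique (Fin 1) (Fin n)) _ _ fun i => ?_
  rw [Fintype.prod_unique]
  congr 2
  ext k
  refine Fin.cases ?_ (fun k => ?_) k
  · simp
  · simp

theorem eval_cons {m : ℕ} (T : Tensor n (m + 1)) (v : Fin n → ℝ) (u : Fin m → Fin n → ℝ) :
    T.eval (Fin.cons v u) = Tensor.eval (n := n) (q := m) (T.fixMany v 1) u := by
  simp only [eval, fixMany_one_apply, Finset.sum_mul]
  rw [← (Fin.consEquiv fun _ => Fin n).sum_comp, Fintype.sum_prod_type, Finset.sum_comm]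
  refine Finset.sum_congr rfl fun i _ => Finset.sum_congr rfl fun a _ => ?_
  have hc : (Fin.consEquiv fun _ => Fin n) (a, i) = Fin.cons a i := rfl
  simp only [hc, Fin.prod_univ_succ, Fin.cons_zero, Fin.cons_succ]
  ring

theorem Symm.eval_eq_zero {T : Tensor n q} (hT : T.Symm) {s : Fin n → ℝ}
    (h : T.fixMany s 1 = 0) {u : Fin q → Fin n → ℝ} {k : Fin q} {c : ℝ} (hk : u k = c • s) :
    T.eval u = 0 := by
  obtain _ | m := q
  · exact k.elim0
  rw [← hT.eval_comp (Equiv.swap 0 k), ← Fin.cons_self_tail (u ∘ Equiv.swap 0 k), eval_cons]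
  have h0 : T.fixMany (c • s) 1 = 0 := by
    ext idx
    have hidx := (fixMany_one_apply T s idx).symm.trans (congrFun h idx)
    refine (fixMany_one_apply T (c • s) idx).trans ?_
    simp only [Pi.smul_apply, smul_eq_mul, mul_assoc, ← Finset.mul_sum, hidx]
    exact mul_zero c
  rw [Function.comp_apply, Equiv.swap_apply_left, hk, h0]
  simp [eval]

theorem Symm.applyMat_sub_vecMulVec {T : Tensor n q} (hT : T.Symm) {s : Fin n → ℝ}
    (h : T.fixMany s 1 = 0) (W : Matrix (Fin n) (Fin n) ℝ) (v : Fin n → ℝ) :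
    T.applyMat (W - vecMulVec s v) = T.applyMat W := by
  ext j
  have key : ∀ t ∈ (Finset.univ : Finset (Fin q)).powerset, t ≠ Finset.univ →
      ∑ i : Fin q → Fin n, T i * ((∏ k ∈ t, W (i k) (j k)) *
        ∏ k ∈ Finset.univ \ t, -(s (i k) * v (j k))) = 0 := by
    intro t _ ht
    obtain ⟨k, hk⟩ : ∃ k, k ∉ t := by
      by_contra! hc
      exact ht (Finset.eq_univ_of_forall hc)
    rw [← hT.eval_eq_zero h (k := k) (c := -v (j k))
      (u := fun k a => if k ∈ t then W a (j k) else -(s a * v (j k)))]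
    · refine Finset.sum_congr rfl fun i _ => ?_
      rw [Finset.prod_ite]
      congr 3 <;> ext <;> simp
    · ext a
      simp [hk, mul_comm]
  simp only [Tensor.applyMat, Matrix.sub_apply, vecMulVec_apply, sub_eq_add_neg, Finset.prod_add,
    Finset.mul_sum]
  rw [Finset.sum_comm, Finset.sum_eq_single Finset.univ key (by simp)]
  simp

theorem fixMany_applyMat_eq_zero (T : Tensor n q) (hq : 1 ≤ q) {V : Matrix (Fin n) (Fin n) ℝ}
    {s : Fin n → ℝ} (hV : V *ᵥ s = 0) : (T.applyMat V).fixMany s 1 = 0 := by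
  obtain ⟨m, rfl⟩ : ∃ m, q = m + 1 := ⟨q - 1, by omega⟩
  ext idx
  refine (fixMany_one_apply _ s idx).trans ?_
  simp only [applyMat, Finset.mul_sum]
  rw [Finset.sum_comm]
  refine Finset.sum_eq_zero fun i _ => ?_
  have hi : ∑ a, V (i 0) a * s a = 0 := congrFun hV (i 0)
  simp only [Fin.prod_univ_succ, Fin.cons_zero, Fin.cons_succ]
  rw [← mul_zero (T i * ∏ k : Fin m, V (i k.succ) (idx k)), ← hi, Finset.mul_sum]
  exact Finset.sum_congr rfl fun a _ => by ring

/-- If `D - X` is orthogonal to `T - X` and `D` is at least as close to `T` as `X` is,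
then `D = X`. -/
theorem eq_of_frobNorm_sub_le {D X T : Tensor n q} (horth : finner (T - X) (D - X) = 0)
    (hle : (D - T).frobNorm ≤ (X - T).frobNorm) : D = X := by
  rw [frobNorm, frobNorm, Real.sqrt_le_sqrt_iff (Finset.sum_nonneg fun i _ => sq_nonneg _)] at hle
  have hsum : ∑ i, (D - T) i ^ 2
      = ∑ i, (D - X) i ^ 2 + ∑ i, (X - T) i ^ 2 - 2 * finner (T - X) (D - X) := by
    rw [finner, Finset.mul_sum, ← Finset.sum_add_distrib, ← Finset.sum_sub_distrib]
    refine Finset.sum_congr rfl fun i _ => ?_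
    simp only [Pi.sub_apply]
    ring
  have hzero : ∑ i, (D - X) i ^ 2 = 0 :=
    le_antisymm (by linarith) (Finset.sum_nonneg fun i _ => sq_nonneg _)
  rw [Finset.sum_eq_zero_iff_of_nonneg fun i _ => sq_nonneg _] at hzero
  ext i
  exact sub_eq_zero.mp (pow_eq_zero_iff two_ne_zero |>.mp (hzero i (Finset.mem_univ i)))

end Tensor

theorem projPerp_transpose {n : ℕ} (w : Fin n → ℝ) : (projPerp w)ᵀ = projPerp w := by
  simp [projPerp, transpose_vecMulVec]

theorem projPerp_mulVec_self {n : ℕ} {w : Fin n → ℝ} (hw : w ≠ 0) : projPerp w *ᵥ w = 0 := by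
  have hww : w ⬝ᵥ w ≠ 0 := fun h => hw (dotProduct_self_eq_zero.mp h)
  rw [projPerp, sub_mulVec, one_mulVec, smul_mulVec, vecMulVec_mulVec, op_smul_eq_smul,
    inv_smul_smul₀ hww, sub_self]

theorem mul_projPerp {n : ℕ} (W : Matrix (Fin n) (Fin n) ℝ) (w : Fin n → ℝ) :
    W * projPerp w = W - vecMulVec (W *ᵥ w) ((w ⬝ᵥ w)⁻¹ • w) := by
  rw [projPerp, mul_sub, mul_one, mul_smul_comm, mul_vecMulVec, vecMulVec_smul]

theorem projPerp_mul_self {n : ℕ} {w : Fin n → ℝ} (hw : w ≠ 0) :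
    projPerp w * projPerp w = projPerp w := by
  rw [mul_projPerp, projPerp_mulVec_self hw, zero_vecMulVec, sub_zero]

/-- the recursive relation
`(C+ - C̃)[W]^p = (C• - C̃)[W]^p [I - W⁻¹ssᵀW⁻ᵀ/(sᵀW⁻ᵀW⁻¹s)]^p`
for the unique least-change symmetric update `C+`. -/
theorem statement3 (n p : ℕ) (hn : 1 ≤ n) (hp : 1 ≤ p)
    (Cb Ct : Tensor n p) (hCb : Cb.Symm) (hCt : Ct.Symm)
    (W : Matrix (Fin n) (Fin n) ℝ) (hW : IsUnit W.det)
    (s : Fin n → ℝ) (hs : s ≠ 0)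
    (Cp : Tensor n p) (hCp : IsSecantUpdate Cb (Ct.fixMany s 1) W s Cp) :
    (Cp - Ct).applyMat W
      = ((Cb - Ct).applyMat W).applyMat (projPerp (W⁻¹ *ᵥ s)) := by
  obtain ⟨hsymm, hfix, hmin⟩ := hCp
  set w := W⁻¹ *ᵥ s with hw
  have hWw : W *ᵥ w = s := by rw [hw, mulVec_mulVec, mul_nonsing_inv W hW, one_mulVec]
  have hw0 : w ≠ 0 := by
    intro h
    rw [h, mulVec_zero] at hWw
    exact hs hWw.symm
  set T := (Cb - Ct).applyMat W with hT
  set D := (Cp - Ct).applyMat W with hD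
  set X := T.applyMat (projPerp w) with hX
  have hXP : X.applyMat (projPerp w) = X := by
    rw [hX, Tensor.applyMat_applyMat, projPerp_mul_self hw0]
  have hDP : D.applyMat (projPerp w) = D := by
    rw [hD, Tensor.applyMat_applyMat, mul_projPerp, hWw]
    exact (hsymm.sub hCt).applyMat_sub_vecMulVec (by rw [Tensor.fixMany_sub, hfix, sub_self]) _ _
  have hXsymm : X.Symm := ((hCb.sub hCt).applyMat W).applyMat _
  have hle := hmin (Ct + X.applyMat W⁻¹) (hCt.add (hXsymm.applyMat _)) (by
    rw [Tensor.fixMany_add, hX, Tensor.applyMat_applyMat, Tensor.fixMany_applyMat_eq_zero _ hp,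
      add_zero]
    rw [← mulVec_mulVec, ← hw, projPerp_mulVec_self hw0])
  have hCpD : (Cp - Cb).applyMat W = D - T := by
    rw [hD, hT, ← Tensor.applyMat_sub, sub_sub_sub_cancel_right]
  have hCX : (Ct + X.applyMat W⁻¹ - Cb).applyMat W = X - T := by
    rw [hT, add_comm, add_sub_assoc, Tensor.applyMat_add, Tensor.applyMat_applyMat,
      nonsing_inv_mul W hW, Tensor.applyMat_one, Tensor.applyMat_sub, Tensor.applyMat_sub]
    abel
  rw [hCpD, hCX] at hle
  refine Tensor.eq_of_frobNorm_sub_le ?_ hle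
  have hEP : (D - X).applyMat (projPerp w)ᵀ = D - X := by
    rw [projPerp_transpose, Tensor.applyMat_sub, hDP, hXP]
  rw [← hEP, ← Tensor.finner_applyMat_left, Tensor.applyMat_sub, hXP, ← hX, sub_self]
  simp [Tensor.finner]
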